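/- Let k be a field, C a finite EI category, M : C ⥤ ModuleCat k a representation, and π : P ⟶ M an essential epimorphism in the functor category with P projective (i.e. a projective cover of M). Then P is supported on C_M: for every object y such that no M-minimal object x has C(x, y) ≠ ∅, one has P(y) = 0. -/

import Mathlib

open CategoryTheory CategoryTheory.Limits

/-- An epimorphism `π : P ⟶ M` in an abelian category is *essential* if every subobject
`N` of `P` with `N ⊔ ker π = ⊤` equals `⊤`. -/
def IsEssentialEpi {A : Type*} [Category A] [Abelian A] {P M : A} (π : P ⟶ M) : Prop :=
  Epi π ∧ ∀ N : Subobject P, N ⊔ kernelSubobject π = ⊤ → N = ⊤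

/-- An object `x` is `M`-minimal if `M x ≠ 0` and `M y = 0` for every `y` admitting a
morphism to `x` and not isomorphic to `x`. -/
def IsMinimalFor (k : Type) [Field k] (C : Type) [SmallCategory C]
    (M : C ⥤ ModuleCat k) (x : C) : Prop :=
  Nontrivial (M.obj x) ∧
    ∀ y : C, Nonempty (y ⟶ x) → IsEmpty (y ≅ x) → ¬ Nontrivial (M.obj y)

/-- In a category whose endomorphisms are all invertible, objects with morphisms both ways
are isomorphic. -/
theorem nonempty_iso_of_hom_of_hom {C : Type*} [Category C]
    (hEI : ∀ (x : C) (f : x ⟶ x), IsIso f) {x y : C} (f : x ⟶ y) (g : y ⟶ x) :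
    Nonempty (x ≅ y) := by
  have hfg := hEI x (f ≫ g)
  have hgf := hEI y (g ≫ f)
  have : Mono f := mono_of_mono f g
  have : IsSplitEpi f := IsSplitEpi.mk' ⟨inv (g ≫ f) ≫ g, by simp⟩
  have : IsIso f := isIso_of_mono_of_isSplitEpi f
  exact ⟨asIso f⟩

/-- Every object at which `M` is nonzero receives a morphism from an `M`-minimal object. -/
theorem exists_isMinimalFor_hom {k : Type} [Field k] {C : Type} [SmallCategory C] [Finite C]
    (hEI : ∀ (x : C) (f : x ⟶ x), IsIso f) (M : C ⥤ ModuleCat k) (z : C)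
    (hz : Nontrivial (M.obj z)) : ∃ x, IsMinimalFor k C M x ∧ Nonempty (x ⟶ z) := by
  let _ : Preorder C :=
    { le := fun a b => Nonempty (a ⟶ b)
      le_refl := fun a => ⟨𝟙 a⟩
      le_trans := fun _ _ _ ⟨f⟩ ⟨g⟩ => ⟨f ≫ g⟩ }
  obtain ⟨x, hxz, hx⟩ :=
    (Set.toFinite {a : C | Nontrivial (M.obj a)}).exists_le_minimal (a := z) hz
  refine ⟨x, ⟨hx.prop, fun y hyx hiso hy => ?_⟩, hxz⟩
  obtain ⟨f⟩ := hyx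
  obtain ⟨g⟩ : Nonempty (x ⟶ y) := hx.le_of_le hy ⟨f⟩
  exact hiso.false (nonempty_iso_of_hom_of_hom hEI f g).some

open scoped Classical in
/-- The subrepresentation of `P` which agrees with `P` on a set `S` of objects closed under
outgoing morphisms, and vanishes elsewhere. -/
noncomputable def restrictSupport {k : Type} [Field k] {C : Type} [SmallCategory C]
    (P : C ⥤ ModuleCat k) (S : Set C) (hS : ∀ ⦃a b : C⦄, (a ⟶ b) → a ∈ S → b ∈ S) :
    C ⥤ ModuleCat k where
  obj z := ModuleCat.of k ↥(if z ∈ S then ⊤ else ⊥ : Submodule k (P.obj z))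
  map {a b} f := ModuleCat.ofHom ((P.map f).hom.restrict fun v hv => by
    by_cases ha : a ∈ S
    · simp [hS f ha]
    · have hv0 : v = 0 := by simpa [ha] using hv
      simp [hv0])
  map_id z := by
    ext v
    simp
  map_comp f g := by
    ext v
    simp

section restrictSupport

variable {k : Type} [Field k] {C : Type} [SmallCategory C]
  (P : C ⥤ ModuleCat k) (S : Set C) (hS : ∀ ⦃a b : C⦄, (a ⟶ b) → a ∈ S → b ∈ S)

/-- The inclusion of `restrictSupport P S hS` into `P`. -/
noncomputable def restrictSupportι : restrictSupport P S hS ⟶ P where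
  app z := ModuleCat.ofHom (Submodule.subtype _)
  naturality a b f := by
    ext v
    rfl

instance mono_restrictSupportι_app (z : C) : Mono ((restrictSupportι P S hS).app z) :=
  (ModuleCat.mono_iff_injective _).2 (Submodule.injective_subtype _)

instance mono_restrictSupportι : Mono (restrictSupportι P S hS) :=
  NatTrans.mono_of_mono_app _

theorem epi_restrictSupportι_app {z : C} (hz : z ∈ S) :
    Epi ((restrictSupportι P S hS).app z) := by
  refine (ModuleCat.epi_iff_surjective _).2 fun v => ⟨⟨v, ?_⟩, rfl⟩
  simp [hz]

theorem isZero_restrictSupport_obj {z : C} (hz : z ∉ S) :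
    IsZero ((restrictSupport P S hS).obj z) := by
  have : Subsingleton ((restrictSupport P S hS).obj z) := by
    refine ⟨fun ⟨v, hv⟩ ⟨w, hw⟩ => Subtype.ext ?_⟩
    have hv0 : v = 0 := by simpa [hz] using hv
    have hw0 : w = 0 := by simpa [hz] using hw
    exact hv0.trans hw0.symm
  exact ModuleCat.isZero_of_subsingleton _

/-- If `M` vanishes outside `S`, then so does the source of any essential epimorphism onto `M`. -/
theorem IsEssentialEpi.isZero_obj {P} {M : C ⥤ ModuleCat k} {π : P ⟶ M}
    (hπ : IsEssentialEpi π) {S : Set C} (hS : ∀ ⦃a b : C⦄, (a ⟶ b) → a ∈ S → b ∈ S)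
    (hM : ∀ z ∉ S, IsZero (M.obj z)) {y : C} (hy : y ∉ S) : IsZero (P.obj y) := by
  have := hπ.1
  let ι := restrictSupportι P S hS
  let N := Subobject.mk ι
  have hN : N = ⊤ := by
    refine hπ.2 N ?_
    have : Epi (N ⊔ kernelSubobject π).arrow := by
      refine Preadditive.epi_of_cancel_zero _ fun {T} g hg => ?_
      have h₁ : ι ≫ g = 0 := by
        rw [← Subobject.ofMkLE_arrow (f := ι) (le_sup_left : N ≤ N ⊔ kernelSubobject π),
          Category.assoc, hg, comp_zero]
      have h₂ : kernel.ι π ≫ g = 0 := by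
        rw [← Subobject.ofMkLE_arrow (f := kernel.ι π)
            (le_sup_right : kernelSubobject π ≤ N ⊔ kernelSubobject π),
          Category.assoc, hg, comp_zero]
      obtain ⟨h, rfl⟩ : ∃ h : M ⟶ T, π ≫ h = g :=
        ⟨Abelian.epiDesc π g h₂, Abelian.comp_epiDesc π g h₂⟩
      ext1
      funext z
      by_cases hz : z ∈ S
      · have := epi_restrictSupportι_app P S hS hz
        rw [← cancel_epi ((restrictSupportι P S hS).app z)]
        simpa using congr_app h₁ z
      · exact (congrArg (· ≫ h.app z) ((hM z hz).eq_zero_of_tgt (π.app z))).trans zero_comp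
    have := isIso_of_mono_of_epi (N ⊔ kernelSubobject π).arrow
    exact Subobject.eq_top_of_isIso_arrow _
  have : IsIso ι := (Subobject.isIso_iff_mk_eq_top ι).2 hN
  exact (isZero_restrictSupport_obj P S hS hy).of_iso (asIso (ι.app y)).symm

end restrictSupport

/-- **The projective cover of `M` is supported on `C_M` (Xu).**
If `π : P ⟶ M` is a projective cover in `C ⥤ ModuleCat k` for a finite EI category `C`,
then `P y = 0` for every object `y` which does not receive a morphism from any
`M`-minimal object. -/
theorem projective_cover_supported_on_C_M
    (k : Type) [Field k] (C : Type) [SmallCategory C]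
    [Fintype (Σ x : C, Σ y : C, x ⟶ y)]
    (hEI : ∀ (x : C) (f : x ⟶ x), IsIso f)
    (M P : C ⥤ ModuleCat k) (π : P ⟶ M)
    (hP : Projective P) (hπ : IsEssentialEpi π)
    (y : C) (hy : ∀ x : C, IsMinimalFor k C M x → ¬ Nonempty (x ⟶ y)) :
    IsZero (P.obj y) := by
  have : Finite C :=
    Finite.of_injective (β := Σ x : C, Σ y : C, x ⟶ y) (fun x => ⟨x, x, 𝟙 x⟩)
      fun _ _ h => congrArg Sigma.fst h
  refine hπ.isZero_obj (S := {z | ∃ x, IsMinimalFor k C M x ∧ Nonempty (x ⟶ z)}) ?_ ?_ ?_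
  · rintro a b f ⟨x, hx, ⟨g⟩⟩
    exact ⟨x, hx, ⟨g ≫ f⟩⟩
  · intro z hz
    have : Subsingleton (M.obj z) :=
      not_nontrivial_iff_subsingleton.1 fun h => hz (exists_isMinimalFor_hom hEI M z h)
    exact ModuleCat.isZero_of_subsingleton _
  · rintro ⟨x, hx, hxy⟩
    exact hy x hx hxy
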